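/- Let μ be a probability measure on 𝒴² × 𝒵 with 𝒴 compact convex and h: 𝒴² → ℝ continuous. Define Π_c as the set of probability measures on 𝒴² × 𝒵 whose (Y(0), Z) and (Y(1), Z) marginals match those of μ. Then the set {E_π[h(Y(0), Y(1))] : π ∈ Π_c} is a closed interval [V_c, Ṽ_c], where V_c and Ṽ_c are respectively the minimum and the maximum of E_π[h(Y(0), Y(1))] over π ∈ Π_c, and both extrema are attained. -/

import Mathlib

open MeasureTheory

/-- Optimal partial-identification bounds: for `μ` on `𝒴² × 𝒵` with `𝒴 ⊆ ℝ^{d_Y}` compact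
convex, `𝒵 ⊆ [0,1]^{d_Z}` closed, and `h` continuous, the set of values `E_π[h(Y(0),Y(1))]`
over couplings `π` matching the `(Y(0),Z)` and `(Y(1),Z)` marginals of `μ` is exactly the
closed interval between its infimum and supremum, and both extrema are attained. -/
theorem optimal_PI_interval (dY dZ : ℕ)
    (Yset : Set (EuclideanSpace ℝ (Fin dY)))
    (hYc : IsCompact Yset) (hYconv : Convex ℝ Yset)
    (Zset : Set (EuclideanSpace ℝ (Fin dZ))) (hZcl : IsClosed Zset)
    (hZcube : ∀ z ∈ Zset, ∀ i, (WithLp.equiv 2 (Fin dZ → ℝ)) z i ∈ Set.Icc (0 : ℝ) 1)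
    (h : Yset → Yset → ℝ) (hcont : Continuous (Function.uncurry h))
    (μ : ProbabilityMeasure (Yset × Yset × Zset)) :
    letI Pic : Set (ProbabilityMeasure (Yset × Yset × Zset)) :=
      {π | (π : Measure (Yset × Yset × Zset)).map (fun p => (p.1, p.2.2)) =
            (μ : Measure (Yset × Yset × Zset)).map (fun p => (p.1, p.2.2)) ∧
           (π : Measure (Yset × Yset × Zset)).map (fun p => (p.2.1, p.2.2)) =
            (μ : Measure (Yset × Yset × Zset)).map (fun p => (p.2.1, p.2.2))}
    letI I : Set ℝ :=
      (fun π : ProbabilityMeasure (Yset × Yset × Zset) =>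
        ∫ p, h p.1 p.2.1 ∂(π : Measure (Yset × Yset × Zset))) '' Pic
    I = Set.Icc (sInf I) (sSup I) ∧ sInf I ∈ I ∧ sSup I ∈ I := by
  have : CompactSpace Yset := isCompact_iff_compactSpace.1 hYc
  have hZc : IsCompact Zset := by
    refine Metric.isCompact_of_isClosed_isBounded hZcl ?_
    have hK : IsCompact ((WithLp.toLp 2 : (Fin dZ → ℝ) → EuclideanSpace ℝ (Fin dZ)) ''
        (Set.univ.pi fun _ => Set.Icc (0 : ℝ) 1)) :=
      (isCompact_univ_pi fun _ => isCompact_Icc).image (PiLp.continuous_toLp 2 _)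
    refine hK.isBounded.subset fun z hz => ⟨WithLp.ofLp z, fun i _ => hZcube z hz i, rfl⟩
  have : CompactSpace Zset := isCompact_iff_compactSpace.1 hZc
  set Pic : Set (ProbabilityMeasure (Yset × Yset × Zset)) :=
      {π | (π : Measure (Yset × Yset × Zset)).map (fun p => (p.1, p.2.2)) =
            (μ : Measure (Yset × Yset × Zset)).map (fun p => (p.1, p.2.2)) ∧
           (π : Measure (Yset × Yset × Zset)).map (fun p => (p.2.1, p.2.2)) =
            (μ : Measure (Yset × Yset × Zset)).map (fun p => (p.2.1, p.2.2))} with hPic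
  set I : Set ℝ :=
      (fun π : ProbabilityMeasure (Yset × Yset × Zset) =>
        ∫ p, h p.1 p.2.1 ∂(π : Measure (Yset × Yset × Zset))) '' Pic with hI
  have hf0 : Continuous (fun p : Yset × Yset × Zset => (p.1, p.2.2)) := by fun_prop
  have hf1 : Continuous (fun p : Yset × Yset × Zset => (p.2.1, p.2.2)) := by fun_prop
  have hh : Continuous (fun p : Yset × Yset × Zset => h p.1 p.2.1) :=
    hcont.comp (by fun_prop : Continuous fun p : Yset × Yset × Zset => (p.1, p.2.1))
  have hint : ∀ π : ProbabilityMeasure (Yset × Yset × Zset),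
      Integrable (fun p : Yset × Yset × Zset => h p.1 p.2.1) (π : Measure (Yset × Yset × Zset)) :=
    fun π => hh.integrable_of_hasCompactSupport (HasCompactSupport.of_compactSpace _)
  have hclosed : IsClosed Pic := by
    have e : Pic = {π | π.map hf0.measurable.aemeasurable = μ.map hf0.measurable.aemeasurable} ∩
        {π | π.map hf1.measurable.aemeasurable = μ.map hf1.measurable.aemeasurable} := by
      ext π
      simp only [Pic, Set.mem_inter_iff, Set.mem_setOf_eq]
      rw [← ProbabilityMeasure.toMeasure_injective.eq_iff,
        ← ProbabilityMeasure.toMeasure_injective.eq_iff]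
      rfl
    rw [e]
    exact (isClosed_eq (ProbabilityMeasure.continuous_map hf0) continuous_const).inter
      (isClosed_eq (ProbabilityMeasure.continuous_map hf1) continuous_const)
  have hIc : IsCompact I := hclosed.isCompact.image
    (ProbabilityMeasure.continuous_integral_continuousMap
      (⟨_, hh⟩ : C(Yset × Yset × Zset, ℝ)))
  have hne : I.Nonempty := ⟨_, μ, ⟨rfl, rfl⟩, rfl⟩
  have hconv : Convex ℝ I := by
    rintro _ ⟨π, hπ, rfl⟩ _ ⟨ρ, hρ, rfl⟩ a b ha hb hab
    have hp : IsProbabilityMeasure (ENNReal.ofReal a • (π : Measure (Yset × Yset × Zset)) +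
        ENNReal.ofReal b • (ρ : Measure (Yset × Yset × Zset))) := by
      constructor
      simp [← ENNReal.ofReal_add ha hb, hab]
    have key : ∀ ν : Measure (Yset × Zset), ENNReal.ofReal a • ν + ENNReal.ofReal b • ν = ν := by
      intro ν
      rw [← add_smul, ← ENNReal.ofReal_add ha hb, hab, ENNReal.ofReal_one, one_smul]
    refine ⟨⟨_, hp⟩, ⟨?_, ?_⟩, ?_⟩
    · rw [ProbabilityMeasure.coe_mk, Measure.map_add _ _ hf0.measurable, Measure.map_smul,
        Measure.map_smul, hπ.1, hρ.1, key]
    · rw [ProbabilityMeasure.coe_mk, Measure.map_add _ _ hf1.measurable, Measure.map_smul,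
        Measure.map_smul, hπ.2, hρ.2, key]
    · simp only [ProbabilityMeasure.coe_mk]
      rw [integral_add_measure ((hint π).smul_measure ENNReal.ofReal_ne_top)
        ((hint ρ).smul_measure ENNReal.ofReal_ne_top), integral_smul_measure,
        integral_smul_measure, ENNReal.toReal_ofReal ha, ENNReal.toReal_ofReal hb]
  exact ⟨eq_Icc_of_connected_compact ⟨hne, hconv.isPreconnected⟩ hIc,
    hIc.sInf_mem hne, hIc.sSup_mem hne⟩
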